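/- Let π be a λ⊕⊸ proof and v a valuation of its Boolean variables. Then the slice v(B(π)) obtained by evaluating the BDT slicing of π under v belongs to the slicing of π: v(B(π)) ∈ 𝒮(π). -/

import Mathlib

/-- Formulas of the intuitionistic multiplicative-additive calculus λ⊕⊸:
atoms, labeled sums `⊕ₓ`, and linear implication `⊸`. -/
inductive Formula : Type
  | atom : ℕ → Formula
  | oplus : ℕ → Formula → Formula → Formula
  | limp : Formula → Formula → Formula
deriving DecidableEq

namespace Formula

/-- Number of atom occurrences of a formula. -/
def size : Formula → ℕ
  | atom _ => 1
  | oplus _ A B => A.size + B.size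
  | limp A B => A.size + B.size

/-- The list of Boolean-variable labels of the `⊕` occurrences of a formula. -/
def labels : Formula → List ℕ
  | atom _ => []
  | oplus x A B => x :: (A.labels ++ B.labels)
  | limp A B => A.labels ++ B.labels

end Formula

/-- Number of atom occurrences of a context. -/
def csz (Γ : List Formula) : ℕ := (Γ.map Formula.size).sum

/-- All labels of `⊕` occurrences of a sequent `Γ ⊢ C`. -/
def seqLabels (Γ : List Formula) (C : Formula) : List ℕ :=
  (Γ.map Formula.labels).flatten ++ C.labels

/-- Cut-free, η-expanded sequent calculus proofs of λ⊕⊸. -/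
inductive Proof : List Formula → Formula → Type
  | ax (a : ℕ) : Proof [.atom a] (.atom a)
  | limpR {Γ : List Formula} {A B : Formula} :
      Proof (Γ ++ [A]) B → Proof Γ (.limp A B)
  | limpL {Γ Δ : List Formula} {A B C : Formula} :
      Proof Γ A → Proof (B :: Δ) C → Proof (Γ ++ .limp A B :: Δ) C
  | ex (Γ₁ Γ₂ Γ₃ : List Formula) (A B : Formula) {C : Formula} :
      Proof (Γ₁ ++ A :: (Γ₂ ++ B :: Γ₃)) C → Proof (Γ₁ ++ B :: (Γ₂ ++ A :: Γ₃)) C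
  | oplusR1 (x : ℕ) {Γ : List Formula} {A B : Formula} :
      Proof Γ A → Proof Γ (.oplus x A B)
  | oplusR2 (x : ℕ) {Γ : List Formula} {A B : Formula} :
      Proof Γ B → Proof Γ (.oplus x A B)
  | oplusL (x : ℕ) {Γ : List Formula} {A B C : Formula} :
      Proof (Γ ++ [A]) C → Proof (Γ ++ [B]) C → Proof (Γ ++ [.oplus x A B]) C

/-- Atom occurrences of a sequent `Γ ⊢ C` are identified with the positions
`0, 1, 2, …` in the left-to-right flattening of `Γ` followed by `C`.
A slice is a finite set of unordered pairs of such positions. -/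
abbrev Slice := Finset (Sym2 ℕ)

/-- Reindexing the atom occurrences of a slice along a map of positions. -/
def Slice.reindex (f : ℕ → ℕ) (l : Slice) : Slice := l.image (Sym2.map f)

/-- Position reindex for the exchange rule: maps the positions of the layout
`[a-block][p-block][b-block][q-block]rest` to those of `[a-block][q-block][b-block][p-block]rest`. -/
def swapMap (a p b q : ℕ) (i : ℕ) : ℕ :=
  if i < a then i
  else if i < a + p then i + q + b
  else if i < a + p + b then i - p + q
  else if i < a + p + b + q then i - p - b
  else i

/-- The slicing 𝒮(π) of a λ⊕⊸ proof. -/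
def Proof.slicing : {Γ : List Formula} → {C : Formula} → Proof Γ C → Finset Slice
  | _, _, .ax _ => {({s(0, 1)} : Slice)}
  | _, _, .limpR p => p.slicing
  | _, _, @Proof.limpL Γ _ A _ _ p q =>
      Finset.image₂ (fun l m => l ∪ Slice.reindex (fun i => i + (csz Γ + A.size)) m)
        p.slicing q.slicing
  | _, _, @Proof.ex Γ₁ Γ₂ _ A B _ p =>
      p.slicing.image (Slice.reindex (swapMap (csz Γ₁) A.size (csz Γ₂) B.size))
  | _, _, .oplusR1 _ p => p.slicing
  | _, _, @Proof.oplusR2 _ Γ A _ p =>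
      p.slicing.image (Slice.reindex (fun i => if i < csz Γ then i else i + A.size))
  | _, _, @Proof.oplusL _ Γ A B _ p q =>
      p.slicing.image (Slice.reindex (fun i => if i < csz Γ + A.size then i else i + B.size))
      ∪ q.slicing.image (Slice.reindex (fun i => if i < csz Γ then i else i + A.size))

/-- Binary decision trees: leaves labeled `0`/`1` (as `Bool`), inner vertices labeled
by Boolean variables; `node x l r` has left subtree `l` and right subtree `r`. -/
inductive BDT : Type
  | leaf : Bool → BDT
  | node : ℕ → BDT → BDT → BDT
deriving DecidableEq

namespace BDT

/-- Evaluation of a BDT under a valuation: go left when the variable is `false` (0),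
right when it is `true` (1). -/
def eval (v : ℕ → Bool) : BDT → Bool
  | leaf b => b
  | node x l r => if v x then r.eval v else l.eval v

/-- Two BDTs are equivalent when they compute the same Boolean function. -/
def Equiv (φ ψ : BDT) : Prop := ∀ v : ℕ → Bool, φ.eval v = ψ.eval v

/-- Variables occurring in a BDT. -/
def vars : BDT → Finset ℕ
  | leaf _ => ∅
  | node x l r => insert x (l.vars ∪ r.vars)

/-- A BDT is free when no variable occurs twice on a path from the root to a leaf. -/
def Free : BDT → Prop
  | leaf _ => True
  | node x l r => x ∉ l.vars ∧ x ∉ r.vars ∧ l.Free ∧ r.Free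

/-- Negation of a BDT: swap the 0/1 labels at the leaves. -/
def neg : BDT → BDT
  | leaf b => leaf !b
  | node x l r => node x l.neg r.neg

end BDT

/-- The BDT slicing B(π) of a proof, as a function of two atom positions of the
conclusion sequent (it is symmetric in the two positions, and `0` on positions
that do not correspond to a pair of atoms of the sequent). -/
def Proof.bdt : {Γ : List Formula} → {C : Formula} → Proof Γ C → ℕ → ℕ → BDT
  | _, _, .ax _, i, j =>
      if (i = 0 ∧ j = 1) ∨ (i = 1 ∧ j = 0) then .leaf true else .leaf false
  | _, _, .limpR p, i, j => p.bdt i j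
  | _, _, @Proof.limpL Γ _ A _ _ p q, i, j =>
      if i < csz Γ + A.size ∧ j < csz Γ + A.size then p.bdt i j
      else if csz Γ + A.size ≤ i ∧ csz Γ + A.size ≤ j then
        q.bdt (i - (csz Γ + A.size)) (j - (csz Γ + A.size))
      else .leaf false
  | _, _, @Proof.ex Γ₁ Γ₂ _ A B _ p, i, j =>
      p.bdt (swapMap (csz Γ₁) B.size (csz Γ₂) A.size i)
            (swapMap (csz Γ₁) B.size (csz Γ₂) A.size j)
  | _, _, @Proof.oplusR1 _ Γ A _ p, i, j =>
      if i < csz Γ + A.size ∧ j < csz Γ + A.size then p.bdt i j else .leaf false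
  | _, _, @Proof.oplusR2 _ Γ A _ p, i, j =>
      if (i < csz Γ ∨ csz Γ + A.size ≤ i) ∧ (j < csz Γ ∨ csz Γ + A.size ≤ j) then
        p.bdt (if i < csz Γ then i else i - A.size) (if j < csz Γ then j else j - A.size)
      else .leaf false
  | _, _, @Proof.oplusL x Γ A B _ p q, i, j =>
      if ((csz Γ ≤ i ∧ i < csz Γ + A.size) ∧ (csz Γ + A.size ≤ j ∧ j < csz Γ + A.size + B.size)) ∨
         ((csz Γ ≤ j ∧ j < csz Γ + A.size) ∧ (csz Γ + A.size ≤ i ∧ i < csz Γ + A.size + B.size)) then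
        .leaf false
      else if (csz Γ ≤ i ∧ i < csz Γ + A.size) ∨ (csz Γ ≤ j ∧ j < csz Γ + A.size) then
        .node x (p.bdt (if i < csz Γ + A.size then i else i - B.size)
                       (if j < csz Γ + A.size then j else j - B.size)) (.leaf false)
      else if (csz Γ + A.size ≤ i ∧ i < csz Γ + A.size + B.size) ∨
              (csz Γ + A.size ≤ j ∧ j < csz Γ + A.size + B.size) then
        .node x (.leaf false) (q.bdt (if i < csz Γ then i else i - A.size)
                                     (if j < csz Γ then j else j - A.size))
      else
        .node x (p.bdt (if i < csz Γ + A.size then i else i - B.size)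
                       (if j < csz Γ + A.size then j else j - B.size))
                (q.bdt (if i < csz Γ then i else i - A.size)
                       (if j < csz Γ then j else j - A.size))

/-- Smaller element of an unordered pair of positions. -/
def pmin (p : Sym2 ℕ) : ℕ := Sym2.lift ⟨fun a b => min a b, fun a b => min_comm a b⟩ p
/-- Larger element of an unordered pair of positions. -/
def pmax (p : Sym2 ℕ) : ℕ := Sym2.lift ⟨fun a b => max a b, fun a b => max_comm a b⟩ p

/-- The BDT slicing B(π) at an unordered pair of atom positions. -/
def Proof.bdtAt {Γ : List Formula} {C : Formula} (π : Proof Γ C) (p : Sym2 ℕ) : BDT :=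
  π.bdt (pmin p) (pmax p)

/-- The slice obtained by evaluating the BDT slicing of `π` under a valuation `v`:
the set of pairs whose BDT evaluates to `1`. -/
def Proof.vslice {Γ : List Formula} {C : Formula} (π : Proof Γ C) (v : ℕ → Bool) :
    Set (Sym2 ℕ) :=
  {p : Sym2 ℕ | (π.bdtAt p).eval v = true}

/-- The labels of the `⊕†` rules of a proof (its Boolean variables). -/
def Proof.labels : {Γ : List Formula} → {C : Formula} → Proof Γ C → List ℕ
  | _, _, .ax _ => []
  | _, _, .limpR p => p.labels
  | _, _, .limpL p q => p.labels ++ q.labels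
  | _, _, .ex _ _ _ _ _ p => p.labels
  | _, _, .oplusR1 _ p => p.labels
  | _, _, .oplusR2 _ p => p.labels
  | _, _, .oplusL x p q => x :: (p.labels ++ q.labels)

/-- Number of rule occurrences of a proof. -/
def Proof.size : {Γ : List Formula} → {C : Formula} → Proof Γ C → ℕ
  | _, _, .ax _ => 1
  | _, _, .limpR p => p.size + 1
  | _, _, .limpL p q => p.size + q.size + 1
  | _, _, .ex _ _ _ _ _ p => p.size + 1
  | _, _, .oplusR1 _ p => p.size + 1
  | _, _, .oplusR2 _ p => p.size + 1
  | _, _, .oplusL x p q => p.size + q.size + 1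

@[simp] theorem csz_nil : csz [] = 0 := rfl

@[simp] theorem csz_cons (A : Formula) (Γ : List Formula) : csz (A :: Γ) = A.size + csz Γ := by
  simp [csz]

@[simp] theorem csz_append (Γ Δ : List Formula) : csz (Γ ++ Δ) = csz Γ + csz Δ := by
  simp [csz]

theorem Slice.mk_mem_reindex {f g : ℕ → ℕ} (hgf : Function.LeftInverse g f) (l : Slice)
    (i j : ℕ) :
    s(i, j) ∈ Slice.reindex f l ↔ f (g i) = i ∧ f (g j) = j ∧ s(g i, g j) ∈ l := by
  simp only [Slice.reindex, Finset.mem_image]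
  constructor
  · rintro ⟨p, hp, h⟩
    induction p with | _ a b =>
    rw [Sym2.map_mk, Sym2.eq_iff] at h
    rcases h with ⟨rfl, rfl⟩ | ⟨rfl, rfl⟩
    · simpa [hgf a, hgf b] using hp
    · simpa [hgf a, hgf b, Sym2.eq_swap] using hp
  · rintro ⟨hi, hj, h⟩
    exact ⟨_, h, by simp [hi, hj]⟩

theorem swapMap_leftInverse (a p b q : ℕ) :
    Function.LeftInverse (swapMap a q b p) (swapMap a p b q) := by
  intro i
  simp only [swapMap]
  split_ifs <;> omega

/-- The map making room for a block of `w` positions inserted at position `n`. -/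
theorem insertBlock_leftInverse (n w : ℕ) :
    Function.LeftInverse (fun i => if i < n then i else i - w)
      (fun i => if i < n then i else i + w) := by
  intro i
  dsimp only
  split_ifs <;> omega

theorem insertBlock_removeBlock_eq_iff (n w i : ℕ) :
    (fun i => if i < n then i else i + w) ((fun i => if i < n then i else i - w) i) = i ↔
      i < n ∨ n + w ≤ i := by
  dsimp only
  split_ifs <;> omega

theorem Slice.mk_mem_reindex_insertBlock (n w : ℕ) (l : Slice) (i j : ℕ) :
    s(i, j) ∈ Slice.reindex (fun i => if i < n then i else i + w) l ↔
      (i < n ∨ n + w ≤ i) ∧ (j < n ∨ n + w ≤ j) ∧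
        s(if i < n then i else i - w, if j < n then j else j - w) ∈ l := by
  rw [Slice.mk_mem_reindex (insertBlock_leftInverse n w), insertBlock_removeBlock_eq_iff,
    insertBlock_removeBlock_eq_iff]

/-- Some slice of `π` agrees with the evaluated BDT slicing on every ordered pair of positions,
and only involves positions of the conclusion. -/
theorem Proof.exists_slice_eval {Γ : List Formula} {C : Formula} (π : Proof Γ C)
    (v : ℕ → Bool) :
    ∃ l ∈ π.slicing, (∀ i j, s(i, j) ∈ l ↔ (π.bdt i j).eval v = true) ∧
      ∀ i j, s(i, j) ∈ l → i < csz Γ + C.size ∧ j < csz Γ + C.size := by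
  induction π with
  | ax a =>
    refine ⟨_, Finset.mem_singleton_self _, fun i j => ?_, fun i j => ?_⟩
    · simp only [Proof.bdt, Finset.mem_singleton, Sym2.eq_iff]
      split_ifs with h <;> simp [BDT.eval, h]
    · simp only [Finset.mem_singleton, Sym2.eq_iff, csz_cons, csz_nil, Formula.size]
      omega
  | limpR p ih =>
    obtain ⟨l, hl, he, hb⟩ := ih
    refine ⟨l, hl, he, fun i j h => ?_⟩
    have := hb i j h
    simp only [csz_append, csz_cons, csz_nil, Formula.size] at this ⊢
    omega
  | @limpL Γ Δ A B C p q ihp ihq =>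
    obtain ⟨l, hl, hel, hbl⟩ := ihp
    obtain ⟨m, hm, hem, hbm⟩ := ihq
    have hmem (i j : ℕ) :=
      Slice.mk_mem_reindex (f := fun i => i + (csz Γ + A.size))
        (g := fun i => i - (csz Γ + A.size)) (fun i => Nat.add_sub_cancel i _) m i j
    refine ⟨_, Finset.mem_image₂_of_mem hl hm, fun i j => ?_, fun i j => ?_⟩
    · rw [Finset.mem_union, hmem]
      have hbl := hbl i j
      simp only [Proof.bdt]
      split_ifs with h₁ h₂
      · rw [← hel, or_iff_left]
        rintro ⟨hi, hj, -⟩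
        omega
      · rw [← hem, or_iff_right fun h => h₁ (hbl h)]
        simp only [Nat.sub_add_cancel h₂.1, Nat.sub_add_cancel h₂.2, true_and]
      · simp only [BDT.eval, Bool.false_eq_true, iff_false]
        rintro (h | ⟨hi, hj, -⟩)
        · exact h₁ (hbl h)
        · omega
    · rw [Finset.mem_union, hmem]
      simp only [csz_append, csz_cons, Formula.size] at hbm ⊢
      rintro (h | ⟨hi, hj, h⟩)
      · have := hbl i j h
        omega
      · have := hbm _ _ h
        omega
  | @ex Γ₁ Γ₂ Γ₃ A B C p ih =>
    obtain ⟨l, hl, he, hb⟩ := ih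
    have hmem (i j : ℕ) :=
      Slice.mk_mem_reindex (swapMap_leftInverse (csz Γ₁) A.size (csz Γ₂) B.size) l i j
    refine ⟨_, Finset.mem_image_of_mem _ hl, fun i j => ?_, fun i j => ?_⟩
    · rw [hmem, he, swapMap_leftInverse _ B.size _ A.size, swapMap_leftInverse _ B.size _ A.size]
      simp [Proof.bdt]
    · rw [hmem]
      rintro ⟨-, -, h⟩
      have := hb _ _ h
      simp only [csz_append, csz_cons, swapMap] at this ⊢
      constructor
      · have := this.1
        split_ifs at this <;> omega
      · have := this.2
        split_ifs at this <;> omega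
  | @oplusR1 x Γ A B p ih =>
    obtain ⟨l, hl, he, hb⟩ := ih
    refine ⟨l, hl, fun i j => ?_, fun i j h => ?_⟩
    · have hb := hb i j
      simp only [Proof.bdt]
      split_ifs with h
      · exact he i j
      · simp only [BDT.eval, Bool.false_eq_true, iff_false]
        exact fun hm => h (hb hm)
    · have := hb i j h
      simp only [Formula.size]
      omega
  | @oplusR2 x Γ A B p ih =>
    obtain ⟨l, hl, he, hb⟩ := ih
    refine ⟨_, Finset.mem_image_of_mem _ hl, fun i j => ?_, fun i j => ?_⟩
    · rw [Slice.mk_mem_reindex_insertBlock, he, ← and_assoc]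
      simp only [Proof.bdt]
      generalize p.bdt _ _ = t
      split_ifs with h <;> simp [BDT.eval, h]
    · rw [Slice.mk_mem_reindex_insertBlock]
      rintro ⟨hi, hj, h⟩
      have := hb _ _ h
      simp only [Formula.size]
      split_ifs at this <;> omega
  | @oplusL x Γ A B C p q ihp ihq =>
    cases hv : v x
    · obtain ⟨l, hl, he, hb⟩ := ihp
      refine ⟨_, Finset.mem_union_left _ (Finset.mem_image_of_mem _ hl), fun i j => ?_,
        fun i j => ?_⟩
      · rw [Slice.mk_mem_reindex_insertBlock, he]
        simp only [Proof.bdt]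
        generalize p.bdt _ _ = t
        generalize q.bdt _ _ = u
        split_ifs <;> simp only [BDT.eval, hv, Bool.false_eq_true, if_false] <;> grind
      · rw [Slice.mk_mem_reindex_insertBlock]
        rintro ⟨hi, hj, h⟩
        have := hb _ _ h
        simp only [csz_append, csz_cons, csz_nil, Formula.size] at this ⊢
        split_ifs at this <;> omega
    · obtain ⟨l, hl, he, hb⟩ := ihq
      refine ⟨_, Finset.mem_union_right _ (Finset.mem_image_of_mem _ hl), fun i j => ?_,
        fun i j => ?_⟩
      · rw [Slice.mk_mem_reindex_insertBlock, he]
        simp only [Proof.bdt]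
        generalize p.bdt _ _ = t
        generalize q.bdt _ _ = u
        split_ifs <;> simp only [BDT.eval, hv, Bool.false_eq_true, if_true] <;> grind
      · rw [Slice.mk_mem_reindex_insertBlock]
        rintro ⟨hi, hj, h⟩
        have := hb _ _ h
        simp only [csz_append, csz_cons, csz_nil, Formula.size] at this ⊢
        split_ifs at this <;> omega

theorem mk_pmin_pmax (p : Sym2 ℕ) : s(pmin p, pmax p) = p := by
  induction p with | _ a b =>
  rcases le_total a b with h | h <;> simp [pmin, pmax, h, Sym2.eq_swap]

/-- Let `π` be a λ⊕⊸ proof (of a sequent with distinct `⊕` labels) and `v` a valuation of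
its Boolean variables.  Then the slice `v(B(π))` obtained by evaluating the BDT slicing of
`π` under `v` belongs to the slicing of `π`: `v(B(π)) ∈ 𝒮(π)`. -/
theorem vslice_mem_slicing
    (Γ : List Formula) (C : Formula) (hlab : (seqLabels Γ C).Nodup)
    (π : Proof Γ C) (v : ℕ → Bool) :
    ∃ l ∈ π.slicing, (l : Set (Sym2 ℕ)) = π.vslice v := by
  obtain ⟨l, hl, he, -⟩ := π.exists_slice_eval v
  refine ⟨l, hl, Set.ext fun p => ?_⟩
  rw [Finset.mem_coe, Proof.vslice, Set.mem_ofPred_eq, Proof.bdtAt, ← he, mk_pmin_pmax]
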